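/- arXiv:2001.11082 — 3 statements merged into one kernel-verified Lean document; each statement's English description precedes it below -/
import Mathlib

section
/- Let G be a group generated by involutions ρ_0, …, ρ_{r−1} whose generating family satisfies the intersection condition, and let H be a group generated by involutions σ_0, …, σ_{s−1} whose generating family satisfies the intersection condition. Then the direct product G × H, together with the generating family of involutions (ρ_0,1), …, (ρ_{r−1},1), (1,σ_0), …, (1,σ_{s−1}), is a C-group; that is, this generating family satisfies the intersection condition. -/
set_option autoImplicit false

noncomputable section

/-! ### C-groups -/

/-- A family of involutions satisfying the intersection condition
(the family is a *C-group* for the group it generates). -/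
def IsCGroup {G : Type*} [Group G] {I : Type*} (ρ : I → G) : Prop :=
  (∀ i, orderOf (ρ i) = 2) ∧
    ∀ J K : Set I,
      Subgroup.closure (ρ '' J) ⊓ Subgroup.closure (ρ '' K) =
        Subgroup.closure (ρ '' (J ∩ K))

/-! ### Incidence systems -/

/-- The data of an incidence system over a type set `I`. -/
structure IncidenceSystem (I : Type*) where
  X : Type*
  t : X → I
  inc : X → X → Prop

namespace IncidenceSystem

variable {I : Type*} (Γ : IncidenceSystem I)

/-- The axioms of an incidence system: incidence is reflexive, symmetric and
two incident elements of the same type are equal. -/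
def IsSystem : Prop :=
  (∀ x, Γ.inc x x) ∧ (∀ x y, Γ.inc x y → Γ.inc y x) ∧
    ∀ x y, Γ.inc x y → Γ.t x = Γ.t y → x = y

/-- A flag: a set of pairwise incident elements. -/
def IsFlag (F : Set Γ.X) : Prop := ∀ x ∈ F, ∀ y ∈ F, Γ.inc x y

/-- A chamber: a flag whose type set is all of `I`. -/
def IsChamber (C : Set Γ.X) : Prop := Γ.IsFlag C ∧ Γ.t '' C = Set.univ

/-- An incidence geometry: every flag is contained in a chamber. -/
def IsGeometry : Prop :=
  Γ.IsSystem ∧ ∀ F : Set Γ.X, Γ.IsFlag F → ∃ C : Set Γ.X, Γ.IsChamber C ∧ F ⊆ C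

/-- The set of elements of the residue of the flag `F`. -/
def residueSet (F : Set Γ.X) : Set Γ.X := {x | x ∉ F ∧ ∀ y ∈ F, Γ.inc x y}

/-- Thin: every residue of rank one has exactly two elements. -/
def IsThin : Prop :=
  ∀ F : Set Γ.X, Γ.IsFlag F → (Set.univ \ Γ.t '' F).ncard = 1 →
    (Γ.residueSet F).ncard = 2

/-- Connectivity of the incidence graph restricted to a set `S`. -/
def ConnOn (S : Set Γ.X) : Prop :=
  ∀ x ∈ S, ∀ y ∈ S,
    Relation.ReflTransGen (fun a b => a ∈ S ∧ b ∈ S ∧ Γ.inc a b) x y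

/-- Connectivity of the incidence graph. -/
def IsConnected : Prop := Γ.ConnOn Set.univ

/-- Residual connectedness: connected and every residue of rank at least two
is connected. -/
def IsResiduallyConnected : Prop :=
  Γ.IsConnected ∧
    ∀ F : Set Γ.X, Γ.IsFlag F → 2 ≤ (Set.univ \ Γ.t '' F).ncard →
      Γ.ConnOn (Γ.residueSet F)

/-- A hypertope: a thin residually connected incidence geometry. -/
def IsHypertope : Prop := Γ.IsGeometry ∧ Γ.IsThin ∧ Γ.IsResiduallyConnected

/-- The group of type-preserving automorphisms. -/
def typeAut : Subgroup (Equiv.Perm Γ.X) where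
  carrier := {α | (∀ x, Γ.t (α x) = Γ.t x) ∧
    ∀ x y, Γ.inc (α x) (α y) ↔ Γ.inc x y}
  one_mem' := ⟨fun _ => rfl, fun _ _ => Iff.rfl⟩
  mul_mem' := by
    rintro a b ⟨ha1, ha2⟩ ⟨hb1, hb2⟩
    refine ⟨fun x => ?_, fun x y => ?_⟩
    · simp only [Equiv.Perm.mul_apply]; rw [ha1, hb1]
    · simp only [Equiv.Perm.mul_apply]; rw [ha2, hb2]
  inv_mem' := by
    rintro a ⟨ha1, ha2⟩
    refine ⟨fun x => ?_, fun x y => ?_⟩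
    · simpa using (ha1 (a⁻¹ x)).symm
    · simpa using (ha2 (a⁻¹ x) (a⁻¹ y)).symm

/-- Transitivity of the type-preserving automorphism group on chambers. -/
def ChamberTransitive : Prop :=
  ∀ C D : Set Γ.X, Γ.IsChamber C → Γ.IsChamber D →
    ∃ α ∈ Γ.typeAut, ⇑α '' C = D

/-- A regular hypertope: a chamber-transitive hypertope. -/
def IsRegularHypertope : Prop := Γ.IsHypertope ∧ Γ.ChamberTransitive

/-- Flag-transitivity: for each type set, the type-preserving automorphism group
is transitive on flags of that type. -/
def FlagTransitive : Prop :=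
  ∀ F G : Set Γ.X, Γ.IsFlag F → Γ.IsFlag G → Γ.t '' F = Γ.t '' G →
    ∃ α ∈ Γ.typeAut, ⇑α '' F = G

/-- `C'` is the chamber `i`-adjacent to the chamber `C`:  it is a chamber
differing from `C` exactly in its element of type `i`. -/
def IAdjacentChamber (C C' : Set Γ.X) (i : I) : Prop :=
  Γ.IsChamber C' ∧ C' ≠ C ∧ ∀ x ∈ C, Γ.t x ≠ i → x ∈ C'

/-- The stabiliser of a flag in the type-preserving automorphism group. -/
def flagStab (F : Set Γ.X) : Subgroup ↥Γ.typeAut where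
  carrier := {α | ∀ x ∈ F, (↑α : Equiv.Perm Γ.X) x = x}
  one_mem' := by intro x hx; simp
  mul_mem' := by
    intro a b ha hb x hx
    simp only [Subgroup.coe_mul, Equiv.Perm.mul_apply]
    rw [hb x hx, ha x hx]
  inv_mem' := by
    intro a ha x hx
    have h2 := congrArg (⇑(↑a : Equiv.Perm Γ.X)⁻¹) (ha x hx)
    simpa using h2.symm

end IncidenceSystem
/-! ### Coset incidence systems -/

/-- The right coset `H g`. -/
def rCoset {G : Type*} [Group G] (H : Subgroup G) (g : G) : Set G :=
  {x | x * g⁻¹ ∈ H}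

/-- The elements of the coset incidence system: right cosets of the `Gi`,
marked by their type. -/
abbrev cosetX {G : Type*} [Group G] {I : Type*} (Gi : I → Subgroup G) : Type _ :=
  Σ i : I, {s : Set G // ∃ g : G, s = rCoset (Gi i) g}

/-- The coset incidence system `Γ(G; (G_i)_{i ∈ I})`: the `i`-elements are the
right cosets of `G_i`, and two cosets are incident iff they meet. -/
def cosetSystem {G : Type*} [Group G] {I : Type*} (Gi : I → Subgroup G) :
    IncidenceSystem I where
  X := cosetX Gi
  t := fun x => x.1
  inc := fun x y => (x.2.1 ∩ y.2.1).Nonempty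

/-- Right multiplication by `g` on the cosets. -/
def cosetMul {G : Type*} [Group G] {I : Type*} (Gi : I → Subgroup G) (g : G) :
    cosetX Gi → cosetX Gi :=
  fun x => ⟨x.1, ⟨(· * g) '' x.2.1, by
    obtain ⟨s, g₀, hg₀⟩ := x.2
    refine ⟨g₀ * g, ?_⟩
    subst hg₀
    ext y
    simp only [Set.mem_image, rCoset, Set.mem_setOf_eq, mul_inv_rev]
    constructor
    · rintro ⟨z, hz, rfl⟩
      simpa [mul_assoc] using hz
    · intro hy
      exact ⟨y * g⁻¹, by simpa [mul_assoc] using hy, by simp⟩⟩⟩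
/-! ### Abstract polytopes -/

/-- A flag of a partially ordered set: a maximal chain. -/
def IsMaxFlag (P : Type*) [PartialOrder P] (F : Set P) : Prop :=
  IsMaxChain (· ≤ ·) F

/-- Strong flag-connectivity: any two flags `F`, `G` are joined by a sequence of
flags, each containing `F ∩ G`, in which consecutive flags differ in exactly
one face. -/
def StronglyFlagConnected (P : Type*) [PartialOrder P] : Prop :=
  ∀ F G : Set P, IsMaxFlag P F → IsMaxFlag P G →
    Relation.ReflTransGen
      (fun A B => IsMaxFlag P A ∧ IsMaxFlag P B ∧ F ∩ G ⊆ A ∧ F ∩ G ⊆ B ∧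
        (A \ B).ncard = 1 ∧ (B \ A).ncard = 1) F G

/-- An abstract polytope of rank `n`: a bounded poset, graded by the rank
function `rk` ranging from `-1` (the least face) to `n` (the greatest face),
each flag containing exactly one face of each rank (hence `n + 2` faces),
satisfying the diamond condition and strong flag-connectivity. -/
def IsPolytope (P : Type*) [PartialOrder P] (rk : P → ℤ) (n : ℕ) : Prop :=
  (∃ b : P, IsBot b ∧ rk b = -1) ∧
  (∃ tp : P, IsTop tp ∧ rk tp = n) ∧
  StrictMono rk ∧
  (∀ F : Set P, IsMaxFlag P F → ∀ k : ℤ, -1 ≤ k → k ≤ (n : ℤ) → ∃ x ∈ F, rk x = k) ∧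
  (∀ x z : P, x < z → rk z = rk x + 2 → {y : P | x < y ∧ y < z}.ncard = 2) ∧
  StronglyFlagConnected P

/-- Non-degenerate: every section of rank 2 is a `p`-gon with `p ≥ 3`,
i.e. has at least three faces of each intermediate rank. -/
def NonDegenerate (P : Type*) [PartialOrder P] (rk : P → ℤ) : Prop :=
  ∀ F G : P, F < G → rk G = rk F + 3 →
    ∃ H₁ H₂ H₃ : P,
      (F < H₁ ∧ H₁ < G ∧ rk H₁ = rk F + 1) ∧
      (F < H₂ ∧ H₂ < G ∧ rk H₂ = rk F + 1) ∧
      (F < H₃ ∧ H₃ < G ∧ rk H₃ = rk F + 1) ∧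
      H₁ ≠ H₂ ∧ H₁ ≠ H₃ ∧ H₂ ≠ H₃

/-- The group of order automorphisms of a poset (the automorphism group of an
abstract polytope). -/
def orderAut (P : Type*) [PartialOrder P] : Subgroup (Equiv.Perm P) where
  carrier := {α | ∀ x y : P, α x ≤ α y ↔ x ≤ y}
  one_mem' := fun _ _ => Iff.rfl
  mul_mem' := by
    intro a b ha hb x y
    simp only [Equiv.Perm.mul_apply]
    rw [ha, hb]
  inv_mem' := by
    intro a ha x y
    simpa using (ha (a⁻¹ x) (a⁻¹ y)).symm

/-- A regular polytope: the automorphism group is transitive on flags. -/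
def IsRegularPolytope (P : Type*) [PartialOrder P] : Prop :=
  ∀ F G : Set P, IsMaxFlag P F → IsMaxFlag P G →
    ∃ α ∈ orderAut P, ⇑α '' F = G

/-- `Φ` is a base flag and `ϱ` the corresponding family of distinguished
generators: `ϱ i` maps `Φ` to the flag `Φ^i` differing from `Φ` exactly in
its face of rank `i`. -/
def IsDistinguishedGens (P : Type*) [PartialOrder P] (rk : P → ℤ) (n : ℕ)
    (Φ : Set P) (ϱ : Fin n → ↥(orderAut P)) : Prop :=
  IsMaxFlag P Φ ∧
    ∀ i : Fin n,
      ⇑(ϱ i).1 '' Φ ≠ Φ ∧ ∀ x ∈ Φ, rk x ≠ (i : ℤ) → x ∈ ⇑(ϱ i).1 '' Φ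

/-- The incidence system associated with an abstract polytope: the elements are
the proper faces (the faces of ranks `0, …, n-1`), the type of a face is its
rank and incidence is comparability. -/
def polytopeSystem (P : Type*) [PartialOrder P] (rk : P → ℤ) (n : ℕ) :
    IncidenceSystem (Fin n) where
  X := {x : P // 0 ≤ rk x ∧ rk x < (n : ℤ)}
  t := fun x => ⟨(rk x.1).toNat, by
    have h1 := x.2.1; have h2 := x.2.2; omega⟩
  inc := fun x y => x.1 ≤ y.1 ∨ y.1 ≤ x.1

/-! ### The halving operation -/

/-- The halving generators: `ρ i = ϱ i` for `i ≤ n - 2` and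
`ρ (n-1) = ϱ (n-1) * ϱ (n-2) * ϱ (n-1)`. -/
def halvingGens {G : Type*} [Group G] (n : ℕ) (ϱ : Fin n → G) : Fin n → G :=
  fun i =>
    if (i : ℕ) = n - 1 then
      ϱ i * ϱ (⟨n - 2, by have := i.isLt; omega⟩ : Fin n) * ϱ i
    else ϱ i

/-- The lift of a generating family into the subgroup it generates. -/
def liftGens {G : Type*} [Group G] {I : Type*} (ρ : I → G) :
    I → ↥(Subgroup.closure (Set.range ρ)) :=
  fun i => ⟨ρ i, Subgroup.subset_closure (Set.mem_range_self i)⟩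

/-- The subgroups `H_i = ⟨ρ_j : j ≠ i⟩` of the halving group `H(P)`,
where `ρ` is the family of halving generators obtained from `ϱ`. -/
def halvingCosetFamily {G : Type*} [Group G] (n : ℕ) (ϱ : Fin n → G) :
    Fin n → Subgroup ↥(Subgroup.closure (Set.range (halvingGens n ϱ))) :=
  fun i => Subgroup.closure (liftGens (halvingGens n ϱ) '' {j | j ≠ i})

/-- The coset incidence system `Γ(H(P); (H_i))` of the halving group. -/
def halvingCosetSystem {G : Type*} [Group G] (n : ℕ) (ϱ : Fin n → G) :
    IncidenceSystem (Fin n) :=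
  cosetSystem (halvingCosetFamily n ϱ)
/-! ### Generalised cubes -/

/-- The vertex set of a polytope: the faces of rank `0`. -/
abbrev polyVertices (K : Type*) (rk : K → ℤ) : Type _ := {v : K // rk v = 0}

/-- The face `F(x)` of the generalised cube `2^K`:
`F(x) = {y : y_v = x_v whenever the vertex v is not incident to F}`. -/
def cubeFace (K : Type*) [PartialOrder K] (rk : K → ℤ) (F : K)
    (x : polyVertices K rk → Bool) : Set (polyVertices K rk → Bool) :=
  {y | ∀ v : polyVertices K rk, ¬ v.1 ≤ F → y v = x v}

/-- Danzer's generalised cube `2^K`: the improper least face `∅` together with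
the sets `F(x)` for `F` a face of `K` (for `F` the least face of `K` this
gives the singletons `{x}`, the vertices of `2^K`; the faces of rank `i ≥ 1`
are the `F(x)` with `rk F = i - 1 ≥ 0`), ordered by inclusion. -/
abbrev genCube (K : Type*) [PartialOrder K] (rk : K → ℤ) : Type _ :=
  {S : Set (polyVertices K rk → Bool) //
    S = ∅ ∨ ∃ (F : K) (x : polyVertices K rk → Bool), S = cubeFace K rk F x}

/-- The rank function of the dual of a polytope of rank `n`. -/
def dualRk {P : Type*} (rk : P → ℤ) (n : ℕ) : Pᵒᵈ → ℤ :=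
  fun x => (n : ℤ) - 1 - rk (OrderDual.ofDual x)

/-- `D2 K rk n`, for `K` a polytope of rank `n`, is the polytope
`D2K = (2^{K*})*`, the dual of the generalised cube over the dual of `K`. -/
abbrev D2 (K : Type*) [PartialOrder K] (rkK : K → ℤ) (n : ℕ) : Type _ :=
  (genCube Kᵒᵈ (dualRk rkK n))ᵒᵈ

/-- The subgroup generated by some of the generators of a direct product is the product of the
subgroups generated in the two factors. -/
lemma closure_image_addCases {G H : Type*} [Group G] [Group H] {r s : ℕ}
    (ρ : Fin r → G) (σ : Fin s → H) (J : Set (Fin (r + s))) :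
    Subgroup.closure ((Fin.addCases (motive := fun _ => G × H)
        (fun i => ((ρ i, 1) : G × H)) (fun j => ((1, σ j) : G × H))) '' J) =
      (Subgroup.closure (ρ '' (Fin.castAdd s ⁻¹' J))).prod
        (Subgroup.closure (σ '' (Fin.natAdd r ⁻¹' J))) := by
  apply le_antisymm
  · rw [Subgroup.closure_le]
    rintro _ ⟨k, hk, rfl⟩
    rw [SetLike.mem_coe, Subgroup.mem_prod]
    induction k using Fin.addCases with
    | left i =>
      rw [Fin.addCases_left]
      exact ⟨Subgroup.subset_closure (Set.mem_image_of_mem ρ hk), one_mem _⟩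
    | right j =>
      rw [Fin.addCases_right]
      exact ⟨one_mem _, Subgroup.subset_closure (Set.mem_image_of_mem σ hk)⟩
  · rw [Subgroup.prod_le_iff, MonoidHom.map_closure, MonoidHom.map_closure,
      Subgroup.closure_le, Subgroup.closure_le]
    constructor
    · rintro _ ⟨_, ⟨i, hi, rfl⟩, rfl⟩
      exact Subgroup.subset_closure ⟨Fin.castAdd s i, hi, Fin.addCases_left i⟩
    · rintro _ ⟨_, ⟨j, hj, rfl⟩, rfl⟩
      exact Subgroup.subset_closure ⟨Fin.natAdd r j, hj, Fin.addCases_right j⟩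

lemma subgroup_prod_inf_prod {G H : Type*} [Group G] [Group H]
    (A B : Subgroup G) (C D : Subgroup H) :
    A.prod C ⊓ B.prod D = (A ⊓ B).prod (C ⊓ D) :=
  SetLike.coe_injective Set.prod_inter_prod

/-- Lemma 2.8: the direct product of two C-groups, with the
combined generating family of involutions, is a C-group. -/
theorem product_of_CGroups_is_CGroup {G H : Type*} [Group G] [Group H]
    {r s : ℕ} (ρ : Fin r → G) (σ : Fin s → H)
    (hρgen : Subgroup.closure (Set.range ρ) = ⊤)
    (hσgen : Subgroup.closure (Set.range σ) = ⊤)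
    (hρ : IsCGroup ρ) (hσ : IsCGroup σ) :
    Subgroup.closure
        (Set.range (Fin.addCases (motive := fun _ => G × H)
          (fun i => ((ρ i, 1) : G × H)) (fun j => ((1, σ j) : G × H)))) = ⊤ ∧
      IsCGroup (Fin.addCases (motive := fun _ => G × H)
        (fun i => ((ρ i, 1) : G × H)) (fun j => ((1, σ j) : G × H))) := by
  refine ⟨?_, fun k => ?_, fun J K => ?_⟩
  · rw [← Set.image_univ, closure_image_addCases, Set.preimage_univ, Set.preimage_univ,
      Set.image_univ, Set.image_univ, hρgen, hσgen, Subgroup.top_prod_top]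
  · induction k using Fin.addCases with
    | left i => simp [Prod.orderOf_mk, hρ.1 i]
    | right j => simp [Prod.orderOf_mk, hσ.1 j]
  · rw [closure_image_addCases, closure_image_addCases, closure_image_addCases,
      subgroup_prod_inf_prod, hρ.2, hσ.2, Set.preimage_inter, Set.preimage_inter]
end
end

section
/- Let G be a group generated by n involutions ρ_0, …, ρ_{n−1}. For i, j ∈ {0, …, n−1} set G_i = ⟨ρ_k : k ≠ i⟩ and G_{i,j} = ⟨ρ_k : k ∉ {i,j}⟩. Suppose that for every i, the group G_i together with its generating involutions (ρ_k)_{k≠i} is a C-group. Then G (with generators ρ_0, …, ρ_{n−1}) is a C-group if and only if G_i ∩ G_j = G_{i,j} for all 0 ≤ i, j ≤ n−1. -/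
set_option autoImplicit false

noncomputable section

/-- Proposition 2.4 / [FL, Prop. 6.1]: if `G` is generated by
involutions `ρ_0, …, ρ_{n-1}` and each maximal parabolic `G_i = ⟨ρ_j : j ≠ i⟩`
(with its generating involutions) is a C-group, then `G` is a C-group if and
only if `G_i ∩ G_j = G_{i,j}` for all `i, j`. -/
theorem isCGroup_iff_pairwise_intersection {G : Type*} [Group G] {n : ℕ}
    (ρ : Fin n → G)
    (hinv : ∀ i, orderOf (ρ i) = 2)
    (hgen : Subgroup.closure (Set.range ρ) = ⊤)
    (hGi : ∀ i : Fin n, ∀ J K : Set (Fin n), J ⊆ {j | j ≠ i} → K ⊆ {j | j ≠ i} →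
      Subgroup.closure (ρ '' J) ⊓ Subgroup.closure (ρ '' K) =
        Subgroup.closure (ρ '' (J ∩ K))) :
    IsCGroup ρ ↔
      ∀ i j : Fin n,
        Subgroup.closure (ρ '' {k | k ≠ i}) ⊓ Subgroup.closure (ρ '' {k | k ≠ j}) =
          Subgroup.closure (ρ '' {k | k ≠ i ∧ k ≠ j}) := by
  refine ⟨fun h i j => h.2 _ _, fun h => ⟨hinv, fun J K => le_antisymm ?_ <| le_inf
    (Subgroup.closure_mono (Set.image_mono Set.inter_subset_left))
    (Subgroup.closure_mono (Set.image_mono Set.inter_subset_right))⟩⟩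
  obtain rfl | hJ_ne := eq_or_ne J Set.univ
  · rw [Set.univ_inter]
    exact inf_le_right
  obtain rfl | hK_ne := eq_or_ne K Set.univ
  · rw [Set.inter_univ]
    exact inf_le_left
  obtain ⟨i, hi⟩ := (Set.ne_univ_iff_exists_notMem J).1 hJ_ne
  obtain ⟨j, hj⟩ := (Set.ne_univ_iff_exists_notMem K).1 hK_ne
  have hJ : J ⊆ {k | k ≠ i} := fun k hk hki => hi (hki ▸ hk)
  have hK : K ⊆ {k | k ≠ j} := fun k hk hkj => hj (hkj ▸ hk)
  rintro x ⟨hxJ, hxK⟩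
  have hx : x ∈ Subgroup.closure (ρ '' {k | k ≠ i ∧ k ≠ j}) :=
    h i j ▸ ⟨Subgroup.closure_mono (Set.image_mono hJ) hxJ,
      Subgroup.closure_mono (Set.image_mono hK) hxK⟩
  have hxJ' : x ∈ Subgroup.closure (ρ '' (J ∩ {k | k ≠ i ∧ k ≠ j})) :=
    (hGi i J {k | k ≠ i ∧ k ≠ j} hJ fun _ hk => hk.1).le ⟨hxJ, hx⟩
  have hxJK : x ∈ Subgroup.closure (ρ '' ((J ∩ {k | k ≠ i ∧ k ≠ j}) ∩ K)) :=
    (hGi j (J ∩ {k | k ≠ i ∧ k ≠ j}) K (fun _ hk => hk.2.2) hK).le ⟨hxJ', hxK⟩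
  exact Subgroup.closure_mono
    (Set.image_mono (Set.inter_subset_inter_left K Set.inter_subset_left)) hxJK
end
end

section
/- Let P be a non-degenerate regular abstract polytope of rank n ≥ 3. Then the halving group H(P) is a subgroup of index at most 2 in Aut(P). -/
set_option autoImplicit false

noncomputable section

/-- A group generated by involutions `ϱ 0, …, ϱ (n - 1)`, whose last one commutes with all others
except possibly `ϱ (n - 2)`, contains its halving subgroup with index at most two. -/
theorem index_closure_halvingGens {G : Type*} [Group G] {n : ℕ} (hn : 2 ≤ n) (ϱ : Fin n → G)
    (hgen : Subgroup.closure (Set.range ϱ) = ⊤) (hinv : ∀ i, ϱ i * ϱ i = 1)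
    (hcomm : ∀ i j : Fin n, (j : ℕ) = n - 1 → (i : ℕ) < n - 2 → ϱ i * ϱ j = ϱ j * ϱ i) :
    (Subgroup.closure (Set.range (halvingGens n ϱ))).index = 1 ∨
      (Subgroup.closure (Set.range (halvingGens n ϱ))).index = 2 := by
  set N := Subgroup.closure (Set.range (halvingGens n ϱ))
  set l : Fin n := ⟨n - 1, by omega⟩ with hl
  have hmem (i : Fin n) (hi : (i : ℕ) ≠ n - 1) : ϱ i ∈ N :=
    Subgroup.subset_closure ⟨i, by simp [halvingGens, hi]⟩
  have hconj (i : Fin n) (hi : (i : ℕ) ≠ n - 1) : ϱ l * ϱ i * ϱ l ∈ N := by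
    by_cases hi2 : (i : ℕ) = n - 2
    · exact Subgroup.subset_closure ⟨l, by simp [halvingGens, hl, ← hi2]⟩
    · rw [← hcomm i l rfl (by omega), mul_assoc, hinv, mul_one]
      exact hmem i hi
  have hinv' (i : Fin n) : (ϱ i)⁻¹ = ϱ i := inv_eq_of_mul_eq_one_left (hinv i)
  have hstep (b : G) (i : Fin n) (hb : b ∈ N ∨ b * ϱ l ∈ N) :
      b * ϱ i ∈ N ∨ b * ϱ i * ϱ l ∈ N := by
    by_cases hi : (i : ℕ) = n - 1
    · obtain rfl : i = l := Fin.ext hi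
      rw [mul_assoc, hinv, mul_one]
      exact hb.symm
    · refine hb.imp (fun h => N.mul_mem h (hmem i hi)) fun h => ?_
      have h2 := N.mul_mem h (hconj i hi)
      rwa [show b * ϱ l * (ϱ l * ϱ i * ϱ l) = b * (ϱ l * ϱ l) * ϱ i * ϱ l by group, hinv,
        mul_one] at h2
  have hcover (b : G) : b ∈ N ∨ b * ϱ l ∈ N := by
    have hb : b ∈ Subgroup.closure (Set.range ϱ) := hgen ▸ Subgroup.mem_top b
    induction hb using Subgroup.closure_induction_right with
    | one => exact Or.inl N.one_mem
    | mul_right x hx y hy ih =>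
      obtain ⟨i, rfl⟩ := hy
      exact hstep _ i ih
    | mul_inv_cancel x hx y hy ih =>
      obtain ⟨i, rfl⟩ := hy
      rw [hinv']
      exact hstep _ i ih
  by_cases hlN : ϱ l ∈ N
  · left
    rw [Subgroup.index_eq_one, eq_top_iff]
    exact fun b _ => (hcover b).elim id fun h => (N.mul_mem_cancel_right hlN).1 h
  · right
    rw [Subgroup.index_eq_two_iff]
    refine ⟨ϱ l, fun b => ?_⟩
    by_cases hb : b ∈ N
    · exact Or.inr ⟨hb, fun h => hlN ((N.mul_mem_cancel_left hb).1 h)⟩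
    · exact Or.inl ⟨(hcover b).resolve_left hb, hb⟩

section OrderAut

variable {P : Type*} [PartialOrder P]

theorem orderAut_le_iff (g : ↥(orderAut P)) (x y : P) : g.1 x ≤ g.1 y ↔ x ≤ y := g.2 x y

theorem orderAut_lt_iff (g : ↥(orderAut P)) (x y : P) : g.1 x < g.1 y ↔ x < y := by
  simp only [lt_iff_le_not_ge, orderAut_le_iff]

theorem orderAut_inv_apply_self (g : ↥(orderAut P)) (x : P) : (g⁻¹).1 (g.1 x) = x := by simp

theorem orderAut_apply_inv_self (g : ↥(orderAut P)) (x : P) : g.1 ((g⁻¹).1 x) = x := by simp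

theorem orderAut_mul_apply (g h : ↥(orderAut P)) (x : P) : (g * h).1 x = g.1 (h.1 x) := rfl

theorem IsMaxFlag.image {F : Set P} (hF : IsMaxFlag P F) (g : ↥(orderAut P)) :
    IsMaxFlag P (g.1 '' F) :=
  IsMaxChain.image (e := (⟨g.1, fun {x y} => g.2 x y⟩ : (· ≤ · : P → P → Prop) ≃r (· ≤ ·))) hF

theorem exists_isMaxFlag_mem (x : P) : ∃ F : Set P, IsMaxFlag P F ∧ x ∈ F := by
  obtain ⟨F, hF, hxF⟩ := IsChain.exists_maxChain (IsChain.singleton (r := (· ≤ ·)) (a := x))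
  exact ⟨F, hF, hxF rfl⟩

variable {rk : P → ℤ} {n : ℕ}

theorem IsPolytope.neg_one_le_rk (hP : IsPolytope P rk n) (x : P) : -1 ≤ rk x := by
  obtain ⟨⟨b, hb, hb1⟩, -, hmono, -⟩ := hP
  exact hb1 ▸ hmono.monotone (hb x)

theorem IsPolytope.rk_le (hP : IsPolytope P rk n) (x : P) : rk x ≤ n := by
  obtain ⟨-, ⟨t, ht, ht1⟩, hmono, -⟩ := hP
  exact ht1 ▸ hmono.monotone (ht x)

theorem IsMaxFlag.lt_of_rk_lt (hP : IsPolytope P rk n) {F : Set P} (hF : IsMaxFlag P F) {x y : P}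
    (hx : x ∈ F) (hy : y ∈ F) (h : rk x < rk y) : x < y := by
  rcases hF.1.total hx hy with hxy | hxy
  · exact lt_of_le_of_ne hxy (by rintro rfl; exact lt_irrefl _ h)
  · exact absurd (hP.2.2.1.monotone hxy) (by omega)

theorem IsMaxFlag.eq_of_rk_eq (hP : IsPolytope P rk n) {F : Set P} (hF : IsMaxFlag P F) {x y : P}
    (hx : x ∈ F) (hy : y ∈ F) (h : rk x = rk y) : x = y := by
  rcases hF.1.total hx hy with hxy | hxy
  · exact hxy.eq_or_lt.elim id fun hlt => absurd (hP.2.2.1 hlt) (by omega)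
  · exact hxy.eq_or_lt.elim Eq.symm fun hlt => absurd (hP.2.2.1 hlt) (by omega)

theorem IsPolytope.rk_le_rk_apply (hP : IsPolytope P rk n) (g : ↥(orderAut P)) (x : P) :
    rk x ≤ rk (g.1 x) := by
  have key (k : ℕ) : ∀ x, rk x = k - 1 → rk x ≤ rk (g.1 x) := by
    induction k with
    | zero =>
      intro x hx
      have := hP.neg_one_le_rk (g.1 x)
      push_cast at hx
      omega
    | succ k ih =>
      intro x hx
      push_cast at hx
      obtain ⟨F, hF, hxF⟩ := exists_isMaxFlag_mem x
      have := hP.rk_le x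
      obtain ⟨y, hyF, hy⟩ := hP.2.2.2.1 F hF (k - 1) (by omega) (by omega)
      have h1 := ih y hy
      have h2 := hP.2.2.1 ((orderAut_lt_iff g y x).2 (hF.lt_of_rk_lt hP hyF hxF (by omega)))
      omega
  have := hP.neg_one_le_rk x
  exact key (rk x + 1).toNat x (by omega)

theorem IsPolytope.rk_apply (hP : IsPolytope P rk n) (g : ↥(orderAut P)) (x : P) :
    rk (g.1 x) = rk x := by
  refine le_antisymm ?_ (hP.rk_le_rk_apply g x)
  simpa using hP.rk_le_rk_apply g⁻¹ (g.1 x)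

/-- By the diamond condition, an interval of length two has at most one face besides a given one. -/
theorem IsPolytope.eq_of_ne_diamond (hP : IsPolytope P rk n) {a b x y z : P}
    (hab : rk b = rk a + 2) (hx : a < x ∧ x < b) (hy : a < y ∧ y < b) (hz : a < z ∧ z < b)
    (hyx : y ≠ x) (hzx : z ≠ x) : y = z := by
  obtain ⟨u, v, -, huv⟩ := Set.ncard_eq_two.1 (hP.2.2.2.2.1 a b (hx.1.trans hx.2) hab)
  have hx' : x ∈ ({u, v} : Set P) := huv ▸ hx
  have hy' : y ∈ ({u, v} : Set P) := huv ▸ hy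
  have hz' : z ∈ ({u, v} : Set P) := huv ▸ hz
  simp only [Set.mem_insert_iff, Set.mem_singleton_iff] at hx' hy' hz'
  grind

/-- An automorphism fixing every face of `Φ`, except its face of rank `i`, which is moved. -/
def FlipsAt (rk : P → ℤ) (Φ : Set P) (i : ℤ) (g : ↥(orderAut P)) : Prop :=
  (∀ x ∈ Φ, rk x ≠ i → g.1 x = x) ∧ ∀ x ∈ Φ, rk x = i → g.1 x ≠ x

theorem IsDistinguishedGens.flipsAt (hP : IsPolytope P rk n) {Φ : Set P}
    {ϱ : Fin n → ↥(orderAut P)} (hϱ : IsDistinguishedGens P rk n Φ ϱ) (i : Fin n) :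
    FlipsAt rk Φ i (ϱ i) := by
  have hfix (x) (hx : x ∈ Φ) (hxi : rk x ≠ (i : ℤ)) : (ϱ i).1 x = x := by
    obtain ⟨z, hz, hzx⟩ := (hϱ.2 i).2 x hx hxi
    obtain rfl : z = x := hϱ.1.eq_of_rk_eq hP hz hx (by rw [← hzx, hP.rk_apply])
    exact hzx
  refine ⟨hfix, fun x hx hxi h => (hϱ.2 i).1 ?_⟩
  have hall (y) (hy : y ∈ Φ) : (ϱ i).1 y = y := by
    by_cases hyi : rk y = i
    · rwa [hϱ.1.eq_of_rk_eq hP hy hx (hyi.trans hxi.symm)]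
    · exact hfix y hy hyi
  simpa using Set.image_congr hall

/-- The diamond condition at the face of rank `i` of a flag, for faces in its orbit. -/
theorem IsPolytope.apply_eq_of_moves (hP : IsPolytope P rk n) {Φ : Set P} (hΦ : IsMaxFlag P Φ)
    {i : ℤ} (hi0 : 0 ≤ i) (hin : i < n) {g h : ↥(orderAut P)}
    (hg : ∀ x ∈ Φ, rk x = i - 1 ∨ rk x = i + 1 → g.1 x = x)
    (hh : ∀ x ∈ Φ, rk x = i - 1 ∨ rk x = i + 1 → h.1 x = x)
    {x : P} (hx : x ∈ Φ) (hxi : rk x = i) (hgx : g.1 x ≠ x) (hhx : h.1 x ≠ x) :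
    g.1 x = h.1 x := by
  obtain ⟨a, ha, hai⟩ := hP.2.2.2.1 Φ hΦ (i - 1) (by omega) (by omega)
  obtain ⟨b, hb, hbi⟩ := hP.2.2.2.1 Φ hΦ (i + 1) (by omega) (by omega)
  have hax : a < x := hΦ.lt_of_rk_lt hP ha hx (by omega)
  have hxb : x < b := hΦ.lt_of_rk_lt hP hx hb (by omega)
  have between (f : ↥(orderAut P)) (hf : ∀ x ∈ Φ, rk x = i - 1 ∨ rk x = i + 1 → f.1 x = x) :
      a < f.1 x ∧ f.1 x < b := by
    have h1 := (orderAut_lt_iff f a x).2 hax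
    have h2 := (orderAut_lt_iff f x b).2 hxb
    rw [hf a ha (Or.inl hai)] at h1
    rw [hf b hb (Or.inr hbi)] at h2
    exact ⟨h1, h2⟩
  exact hP.eq_of_ne_diamond (by omega) ⟨hax, hxb⟩ (between g hg) (between h hh) hgx hhx

theorem FlipsAt.apply_eq (hP : IsPolytope P rk n) {Φ : Set P} (hΦ : IsMaxFlag P Φ)
    {i : ℤ} (hi0 : 0 ≤ i) (hin : i < n) {g h : ↥(orderAut P)} (hg : FlipsAt rk Φ i g)
    (hh : FlipsAt rk Φ i h) {x : P} (hx : x ∈ Φ) : g.1 x = h.1 x := by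
  by_cases hxi : rk x = i
  · exact hP.apply_eq_of_moves hΦ hi0 hin (fun y hy hyi => hg.1 y hy (by omega))
      (fun y hy hyi => hh.1 y hy (by omega)) hx hxi (hg.2 x hx hxi) (hh.2 x hx hxi)
  · rw [hg.1 x hx hxi, hh.1 x hx hxi]

theorem FlipsAt.inv {Φ : Set P} {i : ℤ} {g : ↥(orderAut P)} (hg : FlipsAt rk Φ i g) :
    FlipsAt rk Φ i g⁻¹ := by
  refine ⟨fun x hx hxi => ?_, fun x hx hxi h => hg.2 x hx hxi ?_⟩
  · conv_lhs => rw [← hg.1 x hx hxi]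
    exact orderAut_inv_apply_self g x
  · conv_lhs => rw [← h]
    exact orderAut_apply_inv_self g x

theorem FlipsAt.mul_left_of_fixes {Φ : Set P} {i : ℤ} {g h : ↥(orderAut P)}
    (hg : FlipsAt rk Φ i g) (hh : ∀ x ∈ Φ, h.1 x = x) : FlipsAt rk Φ i (h * g) := by
  refine ⟨fun x hx hxi => ?_, fun x hx hxi he => hg.2 x hx hxi (h.1.injective ?_)⟩
  · rw [orderAut_mul_apply, hg.1 x hx hxi, hh x hx]
  · rw [hh x hx]
    exact he

/-- A flag adjacent to the base flag is its image under a distinguished generator. -/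
theorem IsDistinguishedGens.exists_image_eq (hP : IsPolytope P rk n) {Φ : Set P}
    {ϱ : Fin n → ↥(orderAut P)} (hϱ : IsDistinguishedGens P rk n Φ ϱ) {C : Set P}
    (hC : IsMaxFlag P C) (h1 : (Φ \ C).ncard = 1) (h2 : (C \ Φ).ncard = 1) :
    ∃ i, C = (ϱ i).1 '' Φ := by
  obtain ⟨x, hx⟩ := Set.ncard_eq_one.1 h1
  obtain ⟨y, hy⟩ := Set.ncard_eq_one.1 h2
  have hΦ := hϱ.1
  have hxm : x ∈ Φ \ C := hx ▸ rfl
  have hymem (z) (hzC : z ∈ C) (hzΦ : z ∉ Φ) : z = y :=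
    (hy ▸ (⟨hzC, hzΦ⟩ : z ∈ C \ Φ) : z ∈ ({y} : Set P))
  have hxmem (z) (hzΦ : z ∈ Φ) (hzx : z ≠ x) : z ∈ C := by
    by_contra hzC
    exact hzx (hx ▸ (⟨hzΦ, hzC⟩ : z ∈ Φ \ C) : z ∈ ({x} : Set P))
  have hyC : y ∈ C := (hy ▸ rfl : y ∈ C \ Φ).1
  have hyΦ : y ∉ Φ := (hy ▸ rfl : y ∈ C \ Φ).2
  have hrk : rk y = rk x := by
    obtain ⟨c, hcC, hc⟩ := hP.2.2.2.1 C hC (rk x) (hP.neg_one_le_rk x) (hP.rk_le x)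
    rw [← hymem c hcC fun hcΦ => hxm.2 (hΦ.eq_of_rk_eq hP hcΦ hxm.1 hc ▸ hcC), hc]
  have hx0 : 0 ≤ rk x := by
    by_contra! hlt
    obtain ⟨b, hb, hb1⟩ := hP.1
    have hxb (z : P) (hz : rk z = rk x) : z = b :=
      ((hb z).eq_or_lt.resolve_right fun h => by
        have := hP.2.2.1 h
        omega).symm
    exact hyΦ ((hxb y hrk).trans (hxb x rfl).symm ▸ hxm.1)
  have hxn : rk x < n := by
    by_contra! hlt
    obtain ⟨t, ht, ht1⟩ := hP.2.1
    have hxt (z : P) (hz : rk z = rk x) : z = t :=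
      (ht z).eq_or_lt.resolve_right fun h => by
        have := hP.2.2.1 h
        omega
    exact hyΦ ((hxt y hrk).trans (hxt x rfl).symm ▸ hxm.1)
  let i : Fin n := ⟨(rk x).toNat, by omega⟩
  have hi : (i : ℤ) = rk x := Int.toNat_of_nonneg hx0
  have hflip := hϱ.flipsAt hP i
  have hyi : y = (ϱ i).1 x := by
    obtain ⟨a, ha, hai⟩ := hP.2.2.2.1 Φ hΦ (rk x - 1) (by omega) (by omega)
    obtain ⟨b, hb, hbi⟩ := hP.2.2.2.1 Φ hΦ (rk x + 1) (by omega) (by omega)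
    have haC : a ∈ C := hxmem a ha (by rintro rfl; omega)
    have hbC : b ∈ C := hxmem b hb (by rintro rfl; omega)
    have hax : a < x := hΦ.lt_of_rk_lt hP ha hxm.1 (by omega)
    have hxb : x < b := hΦ.lt_of_rk_lt hP hxm.1 hb (by omega)
    have h1 := (orderAut_lt_iff (ϱ i) a x).2 hax
    have h2 := (orderAut_lt_iff (ϱ i) x b).2 hxb
    rw [hflip.1 a ha (by omega)] at h1
    rw [hflip.1 b hb (by omega)] at h2
    exact hP.eq_of_ne_diamond (by omega) ⟨hax, hxb⟩
      ⟨hC.lt_of_rk_lt hP haC hyC (by omega), hC.lt_of_rk_lt hP hyC hbC (by omega)⟩ ⟨h1, h2⟩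
      (by rintro rfl; exact hyΦ hxm.1) (hflip.2 x hxm.1 hi.symm)
  refine ⟨i, hC.2 (hΦ.image (ϱ i)).1 fun z hz => ?_⟩
  by_cases hzΦ : z ∈ Φ
  · refine (hϱ.2 i).2 z hzΦ fun hzi => hxm.2 ?_
    rwa [← hΦ.eq_of_rk_eq hP hzΦ hxm.1 (hzi.trans hi)]
  · rw [hymem z hz hzΦ, hyi]
    exact Set.mem_image_of_mem _ hxm.1

theorem IsDistinguishedGens.exists_mem_closure_image_eq (hP : IsPolytope P rk n) {Φ : Set P}
    {ϱ : Fin n → ↥(orderAut P)} (hϱ : IsDistinguishedGens P rk n Φ ϱ) {F : Set P}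
    (hF : IsMaxFlag P F) : ∃ g ∈ Subgroup.closure (Set.range ϱ), F = g.1 '' Φ := by
  have hpath := hP.2.2.2.2.2 Φ F hϱ.1 hF
  generalize Φ ∩ F = D at hpath
  clear hF
  induction hpath with
  | refl => exact ⟨1, one_mem _, by simp⟩
  | @tail A B _ hAB ih =>
    obtain ⟨g, hg, rfl⟩ := ih
    obtain ⟨-, hB, -, -, h1, h2⟩ := hAB
    have hB' : B = g.1 '' ((g⁻¹).1 '' B) := by
      simp [Set.image_image]
    rw [hB', ← Set.image_sdiff g.1.injective, Set.ncard_image_of_injective _ g.1.injective] at h1 h2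
    obtain ⟨i, hi⟩ := hϱ.exists_image_eq hP (hB.image g⁻¹) h1 h2
    refine ⟨g * ϱ i, mul_mem hg (Subgroup.subset_closure ⟨i, rfl⟩), ?_⟩
    rw [hB', hi, Set.image_image]
    rfl

/-- An automorphism fixing the faces of the base flag is trivial. -/
theorem IsDistinguishedGens.eq_one_of_fixes (hP : IsPolytope P rk n) {Φ : Set P}
    {ϱ : Fin n → ↥(orderAut P)} (hϱ : IsDistinguishedGens P rk n Φ ϱ) {h : ↥(orderAut P)}
    (hh : ∀ x ∈ Φ, h.1 x = x) : h = 1 := by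
  have hflip {i : Fin n} {f s : ↥(orderAut P)} (hs : FlipsAt rk Φ i s)
      (hf : ∀ x ∈ Φ, f.1 x = x) : ∀ x ∈ Φ, (s⁻¹ * f * s).1 x = x := fun x hx => by
    have := (hs.mul_left_of_fixes hf).apply_eq hP hϱ.1 (by omega) (by omega) hs hx
    rw [mul_assoc, orderAut_mul_apply, this, orderAut_inv_apply_self]
  have hconj (g) (hg : g ∈ Subgroup.closure (Set.range ϱ)) :
      ∀ x ∈ Φ, (g⁻¹ * h * g).1 x = x := by
    induction hg using Subgroup.closure_induction_right with
    | one => simpa using hh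
    | mul_right a _ s hs ih =>
      obtain ⟨i, rfl⟩ := hs
      simpa only [mul_inv_rev, mul_assoc] using hflip (hϱ.flipsAt hP i) ih
    | mul_inv_cancel a _ s hs ih =>
      obtain ⟨i, rfl⟩ := hs
      simpa only [mul_inv_rev, mul_assoc] using hflip (hϱ.flipsAt hP i).inv ih
  refine Subtype.ext (Equiv.ext fun x => ?_)
  obtain ⟨F, hF, hxF⟩ := exists_isMaxFlag_mem x
  obtain ⟨g, hg, rfl⟩ := hϱ.exists_mem_closure_image_eq hP hF
  obtain ⟨y, hy, rfl⟩ := hxF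
  have := congrArg g.1 (hconj g hg y hy)
  rwa [mul_assoc, orderAut_mul_apply, orderAut_apply_inv_self] at this

theorem IsDistinguishedGens.eq_of_eqOn (hP : IsPolytope P rk n) {Φ : Set P}
    {ϱ : Fin n → ↥(orderAut P)} (hϱ : IsDistinguishedGens P rk n Φ ϱ) {g h : ↥(orderAut P)}
    (hgh : ∀ x ∈ Φ, g.1 x = h.1 x) : g = h := by
  refine (inv_mul_eq_one.1 (hϱ.eq_one_of_fixes hP fun x hx => ?_)).symm
  rw [orderAut_mul_apply, hgh x hx, orderAut_inv_apply_self]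

theorem IsDistinguishedGens.closure_eq_top (hP : IsPolytope P rk n) {Φ : Set P}
    {ϱ : Fin n → ↥(orderAut P)} (hϱ : IsDistinguishedGens P rk n Φ ϱ) :
    Subgroup.closure (Set.range ϱ) = ⊤ := by
  refine eq_top_iff.2 fun h _ => ?_
  obtain ⟨g, hg, hgΦ⟩ := hϱ.exists_mem_closure_image_eq hP (hϱ.1.image h)
  rwa [hϱ.eq_of_eqOn hP (g := h) (h := g) fun x hx => ?_]
  have hmem : h.1 x ∈ g.1 '' Φ := hgΦ ▸ Set.mem_image_of_mem _ hx
  exact (hϱ.1.image g).eq_of_rk_eq hP hmem (Set.mem_image_of_mem _ hx)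
    (by rw [hP.rk_apply, hP.rk_apply])

theorem IsDistinguishedGens.mul_self (hP : IsPolytope P rk n) {Φ : Set P}
    {ϱ : Fin n → ↥(orderAut P)} (hϱ : IsDistinguishedGens P rk n Φ ϱ) (i : Fin n) :
    ϱ i * ϱ i = 1 := by
  have hf := hϱ.flipsAt hP i
  exact mul_eq_one_iff_eq_inv.2
    (hϱ.eq_of_eqOn hP fun x hx => hf.apply_eq hP hϱ.1 (by omega) (by omega) hf.inv hx)

theorem IsDistinguishedGens.mul_comm_of_lt (hP : IsPolytope P rk n) {Φ : Set P}
    {ϱ : Fin n → ↥(orderAut P)} (hϱ : IsDistinguishedGens P rk n Φ ϱ) {i j : Fin n}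
    (hij : (i : ℕ) + 1 < j) : ϱ i * ϱ j = ϱ j * ϱ i := by
  have hi := hϱ.flipsAt hP i
  have hj := hϱ.flipsAt hP j
  have swap {k l : Fin n} (hkl : (k : ℕ) + 1 < l ∨ (l : ℕ) + 1 < k) {x : P} (hx : x ∈ Φ)
      (hxl : rk x = l) : (ϱ k).1 ((ϱ l).1 x) = (ϱ l).1 x := by
    have hk := hϱ.flipsAt hP k
    have hl := hϱ.flipsAt hP l
    have hkx : (ϱ k).1 x = x := hk.1 x hx (by omega)
    refine hP.apply_eq_of_moves hϱ.1 (i := l) (g := ϱ k * ϱ l) (by omega) (by omega)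
      (fun y hy hyl => ?_) (fun y hy hyl => hl.1 y hy (by omega)) hx hxl
      (fun h => hl.2 x hx hxl ((ϱ k).1.injective (h.trans hkx.symm))) (hl.2 x hx hxl)
    rw [orderAut_mul_apply, hl.1 y hy (by omega), hk.1 y hy (by omega)]
  refine hϱ.eq_of_eqOn hP fun x hx => ?_
  rw [orderAut_mul_apply, orderAut_mul_apply]
  by_cases hxi : rk x = i
  · rw [hj.1 x hx (by omega), swap (Or.inr hij) hx hxi]
  · by_cases hxj : rk x = j
    · rw [hi.1 x hx hxi, swap (Or.inl hij) hx hxj]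
    · rw [hi.1 x hx hxi, hj.1 x hx hxj, hi.1 x hx hxi]

end OrderAut

/-- the halving group `H(P)` of a non-degenerate regular
polytope of rank `n ≥ 3` has index at most `2` in `Aut(P)`. -/
theorem halvingGroup_index_le_two {P : Type*} [PartialOrder P]
    (rk : P → ℤ) (n : ℕ) (hn : 3 ≤ n)
    (hP : IsPolytope P rk n) (hnd : NonDegenerate P rk)
    (hreg : IsRegularPolytope P)
    (Φ : Set P) (ϱ : Fin n → ↥(orderAut P))
    (hϱ : IsDistinguishedGens P rk n Φ ϱ) :
    (Subgroup.closure (Set.range (halvingGens n ϱ))).index = 1 ∨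
      (Subgroup.closure (Set.range (halvingGens n ϱ))).index = 2 :=
  index_closure_halvingGens (by omega) ϱ (hϱ.closure_eq_top hP) (hϱ.mul_self hP)
    fun _ _ hj hi => hϱ.mul_comm_of_lt hP (by omega)
end
end
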